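/- Multiplication rule in the cohomology of the raviolo: Let R = ℂ[z,λ,x]/(zλ + x² − 1) with the derivation e induced by z ∂/∂x − 2x ∂/∂λ, and for m ≥ 0 set Ω^m = ((2m+1)!!/(2^m m!)) λ^m ∈ R, where (2m+1)!! = 1·3·5⋯(2m+1). Then for all integers n, m ≥ 0: if n ≤ m then z^n Ω^m − Ω^{m−n} ∈ e(R), and if n > m then z^n Ω^m ∈ e(R). (Hence in H¹ = R/e(R) the classes Ω^m satisfy z^n Ω^m = Ω^{m−n} for n ≤ m and z^n Ω^m = 0 for n > m.) -/

import Mathlib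

open MvPolynomial

noncomputable section

/-- The defining ideal `(zλ + x² − 1)` of the algebraic model of the raviolo, with
`z = X 0`, `λ = X 1`, `x = X 2`. -/
def RavPolyIdeal : Ideal (MvPolynomial (Fin 3) ℂ) :=
  Ideal.span {X 0 * X 1 + X 2 ^ 2 - 1}

/-- The ring `R = ℂ[z,λ,x]/(zλ + x² − 1)`. -/
abbrev RavR := MvPolynomial (Fin 3) ℂ ⧸ RavPolyIdeal

/-- The derivation `e = z ∂/∂x − 2x ∂/∂λ` on `ℂ[z,λ,x]`. -/
def ePoly (p : MvPolynomial (Fin 3) ℂ) : MvPolynomial (Fin 3) ℂ :=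
  X 0 * pderiv 2 p - 2 * X 2 * pderiv 1 p

/-- The odd double factorial `(2m+1)!! = 1·3·5⋯(2m+1)`. -/
def oddDoubleFactorial (m : ℕ) : ℕ := ∏ i ∈ Finset.range (m + 1), (2 * i + 1)

/-- `Ω^m = ((2m+1)!!/(2^m m!)) λ^m` in `R`. -/
def OmegaR (m : ℕ) : RavR :=
  ((oddDoubleFactorial m : ℂ) / ((2 : ℂ) ^ m * (m.factorial : ℂ))) •
    Ideal.Quotient.mk RavPolyIdeal (X 1 ^ m)

/-- The range of `e` is stable under multiplication by `z`. -/
lemma range_z_stable (e : RavR →ₗ[ℂ] RavR)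
    (he : ∀ p : MvPolynomial (Fin 3) ℂ,
      e (Ideal.Quotient.mk RavPolyIdeal p) = Ideal.Quotient.mk RavPolyIdeal (ePoly p))
    (r : RavR) (hr : r ∈ LinearMap.range e) :
    Ideal.Quotient.mk RavPolyIdeal (X 0) * r ∈ LinearMap.range e := by
  obtain ⟨q, rfl⟩ := hr
  obtain ⟨p, rfl⟩ := Ideal.Quotient.mk_surjective q
  refine ⟨Ideal.Quotient.mk RavPolyIdeal (X 0 * p), ?_⟩
  rw [he, he, ← map_mul]
  congr 1
  have h1 : pderiv (2 : Fin 3) (X 0 : MvPolynomial (Fin 3) ℂ) = 0 :=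
    pderiv_X_of_ne (by decide)
  have h2 : pderiv (1 : Fin 3) (X 0 : MvPolynomial (Fin 3) ℂ) = 0 :=
    pderiv_X_of_ne (by decide)
  simp only [ePoly, Derivation.leibniz, h1, h2, smul_eq_mul]
  ring

lemma z_Omega_zero (e : RavR →ₗ[ℂ] RavR)
    (he : ∀ p : MvPolynomial (Fin 3) ℂ,
      e (Ideal.Quotient.mk RavPolyIdeal p) = Ideal.Quotient.mk RavPolyIdeal (ePoly p)) :
    Ideal.Quotient.mk RavPolyIdeal (X 0) * OmegaR 0 ∈ LinearMap.range e := by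
  refine ⟨Ideal.Quotient.mk RavPolyIdeal (X 2), ?_⟩
  have h2 : pderiv (1 : Fin 3) (X 2 : MvPolynomial (Fin 3) ℂ) = 0 :=
    pderiv_X_of_ne (by decide)
  rw [he]
  simp [ePoly, h2, OmegaR, oddDoubleFactorial]

lemma e_x_lambda (e : RavR →ₗ[ℂ] RavR)
    (he : ∀ p : MvPolynomial (Fin 3) ℂ,
      e (Ideal.Quotient.mk RavPolyIdeal p) = Ideal.Quotient.mk RavPolyIdeal (ePoly p))
    (m : ℕ) :
    e (Ideal.Quotient.mk RavPolyIdeal (X 2 * X 1 ^ (m + 1))) =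
      (2 * m + 3 : ℂ) • (Ideal.Quotient.mk RavPolyIdeal (X 0) *
        Ideal.Quotient.mk RavPolyIdeal (X 1 ^ (m + 1)))
      - (2 * (m + 1) : ℂ) • Ideal.Quotient.mk RavPolyIdeal (X 1 ^ m) := by
  have h1 : pderiv (2 : Fin 3) (X 1 : MvPolynomial (Fin 3) ℂ) = 0 :=
    pderiv_X_of_ne (by decide)
  have h2 : pderiv (1 : Fin 3) (X 2 : MvPolynomial (Fin 3) ℂ) = 0 :=
    pderiv_X_of_ne (by decide)
  have hs : ∀ (c : ℂ) (p : MvPolynomial (Fin 3) ℂ),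
      c • Ideal.Quotient.mk RavPolyIdeal p = Ideal.Quotient.mk RavPolyIdeal (C c * p) := by
    intro c p
    rw [← smul_eq_C_mul]
    rfl
  rw [he, ← map_mul, hs, hs, ← map_sub, Ideal.Quotient.eq, RavPolyIdeal,
    Ideal.mem_span_singleton]
  refine ⟨- (2 * ((m : MvPolynomial (Fin 3) ℂ) + 1)) * X 1 ^ m, ?_⟩
  simp only [ePoly, Derivation.leibniz, Derivation.leibniz_pow, h1, h2, smul_eq_mul,
    pderiv_X_self, map_add, map_mul, map_natCast, map_ofNat, map_one, nsmul_eq_mul,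
    Nat.add_sub_cancel, Nat.cast_add, Nat.cast_one]
  ring

lemma z_Omega_succ (e : RavR →ₗ[ℂ] RavR)
    (he : ∀ p : MvPolynomial (Fin 3) ℂ,
      e (Ideal.Quotient.mk RavPolyIdeal p) = Ideal.Quotient.mk RavPolyIdeal (ePoly p))
    (m : ℕ) :
    Ideal.Quotient.mk RavPolyIdeal (X 0) * OmegaR (m + 1) - OmegaR m
      ∈ LinearMap.range e := by
  refine ⟨((oddDoubleFactorial m : ℂ) / ((2 : ℂ) ^ m * (m.factorial : ℂ)) / (2 * (m + 1))) •
    Ideal.Quotient.mk RavPolyIdeal (X 2 * X 1 ^ (m + 1)), ?_⟩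
  have hm : (m + 1 : ℂ) ≠ 0 := by exact_mod_cast Nat.succ_ne_zero m
  have hf : (m.factorial : ℂ) ≠ 0 := by exact_mod_cast m.factorial_ne_zero
  have hd : oddDoubleFactorial (m + 1) = oddDoubleFactorial m * (2 * (m + 1) + 1) := by
    simp only [oddDoubleFactorial]
    rw [Finset.prod_range_succ]
  rw [map_smul, e_x_lambda e he, smul_sub, smul_smul, smul_smul, OmegaR, OmegaR,
    mul_smul_comm, hd, Nat.factorial_succ]
  congr 2
  · push_cast
    field_simp
    ring
  · field_simp

/-- Multiplication rule in the cohomology of the raviolo: modulo `e(R)`,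
`z^n Ω^m = Ω^{m−n}` for `n ≤ m` and `z^n Ω^m = 0` for `n > m`. -/
theorem raviolo_multiplication_rule (e : RavR →ₗ[ℂ] RavR)
    (he : ∀ p : MvPolynomial (Fin 3) ℂ,
      e (Ideal.Quotient.mk RavPolyIdeal p) = Ideal.Quotient.mk RavPolyIdeal (ePoly p)) :
    ∀ n m : ℕ,
      (n ≤ m → Ideal.Quotient.mk RavPolyIdeal (X 0) ^ n * OmegaR m - OmegaR (m - n)
        ∈ LinearMap.range e) ∧
      (m < n → Ideal.Quotient.mk RavPolyIdeal (X 0) ^ n * OmegaR m ∈ LinearMap.range e) := by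
  intro n m
  induction n with
  | zero => simp
  | succ n ih =>
    constructor
    · intro h
      have h1 := range_z_stable e he _ (ih.1 (by omega))
      have h2 := z_Omega_succ e he (m - (n + 1))
      rw [show m - (n + 1) + 1 = m - n by omega] at h2
      have h3 := add_mem h1 h2
      convert h3 using 1
      ring
    · intro h
      rcases Nat.lt_or_ge m n with h' | h'
      · have h1 := range_z_stable e he _ (ih.2 h')
        convert h1 using 1
        ring
      · obtain rfl : m = n := by omega
        have h1 := range_z_stable e he _ (ih.1 le_rfl)
        have h2 := z_Omega_zero e he
        rw [Nat.sub_self] at h1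
        have h3 := add_mem h1 h2
        convert h3 using 1
        ring
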